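/- Let Ω be an exterior domain in ℝ³ with real-analytic boundary ∂Ω and outward unit normal ν. Then there exists a constant C > 0 such that for every vector field v ∈ H¹(Ω;ℝ³) with v·ν = 0 on ∂Ω: ‖∇v‖_{L²(Ω)} ≤ C ( ‖div v‖_{L²(Ω)} + ‖curl v‖_{L²(Ω)} + ‖v‖_{L²(Ω)} ). -/

import Mathlib

open MeasureTheory Finset

noncomputable section

/-- The ambient space `ℝ³`. -/
abbrev E3 : Type := EuclideanSpace ℝ (Fin 3)

/-- Partial derivative in coordinate direction `i`. -/
def pd (i : Fin 3) (f : E3 → ℝ) : E3 → ℝ :=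
  fun x => fderiv ℝ f x (EuclideanSpace.single i 1)

/-- Iterated coordinate derivatives along a list of directions. -/
def pdList : List (Fin 3) → (E3 → ℝ) → (E3 → ℝ)
  | [], f => f
  | i :: l, f => pd i (pdList l f)

/-- The `L²` norm of a scalar function on a set `Ω`. -/
def L2 (Ω : Set E3) (f : E3 → ℝ) : ℝ :=
  Real.sqrt (∫ x in Ω, (f x) ^ 2)

/-- The `L²` norm of a vector field on a set `Ω`. -/
def L2v (Ω : Set E3) (v : E3 → Fin 3 → ℝ) : ℝ :=
  Real.sqrt (∫ x in Ω, ∑ i, (v x i) ^ 2)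

/-- Sum of the `L²` norms of all coordinate derivatives of order `j`. -/
def DnormL2 (Ω : Set E3) (j : ℕ) (f : E3 → ℝ) : ℝ :=
  ∑ ι : Fin j → Fin 3, L2 Ω (pdList (List.ofFn ι) f)

/-- The Sobolev `H^m` norm (all derivatives of order at most `m` in `L²`). -/
def HnormL2 (Ω : Set E3) (m : ℕ) (f : E3 → ℝ) : ℝ :=
  ∑ j ∈ Finset.range (m + 1), DnormL2 Ω j f

/-- Order-`j` derivative norm of a vector field. -/
def DnormL2v (Ω : Set E3) (j : ℕ) (v : E3 → Fin 3 → ℝ) : ℝ :=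
  ∑ m : Fin 3, DnormL2 Ω j (fun x => v x m)

/-- Sobolev `H^m` norm of a vector field. -/
def HnormL2v (Ω : Set E3) (m : ℕ) (v : E3 → Fin 3 → ℝ) : ℝ :=
  ∑ j ∈ Finset.range (m + 1), DnormL2v Ω j v

/-- Square-integrability of all derivatives of order at most `m`
(classical-derivative rendering of membership in `H^m`). -/
def InH (Ω : Set E3) (m : ℕ) (f : E3 → ℝ) : Prop :=
  ∀ l : List (Fin 3), l.length ≤ m → IntegrableOn (fun x => (pdList l f x) ^ 2) Ω

/-- The signed distance to the boundary of `Ω`, positive inside `Ω`. -/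
def sdist (Ω : Set E3) (x : E3) : ℝ :=
  Metric.infDist x Ωᶜ - Metric.infDist x Ω

/-- The outward unit normal, extended as `ν = -∇d` via the signed distance. -/
def nuv (Ω : Set E3) (x : E3) (i : Fin 3) : ℝ := -(pd i (sdist Ω) x)

/-- The collar neighborhood `Ω_{δ₀} = {x ∈ Ω : d(x) < δ₀}` of the boundary. -/
def collar (Ω : Set E3) (δ₀ : ℝ) : Set E3 := {x ∈ Ω | sdist Ω x < δ₀}

/-- `Ω ⊆ ℝ³` is an exterior domain: an open set lying on one side of its
nonempty compact boundary (equivalently, the complement is compact). -/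
structure ExteriorDomain (Ω : Set E3) : Prop where
  isOpen : IsOpen Ω
  compl_compact : IsCompact Ωᶜ
  bdry_nonempty : (frontier Ω).Nonempty

/-- `Ω` has a real-analytic boundary: the signed distance function is
real-analytic and noncritical on a neighborhood of the boundary. -/
def AnalyticBoundary (Ω : Set E3) : Prop :=
  ∃ U : Set E3, IsOpen U ∧ frontier Ω ⊆ U ∧ AnalyticOnNhd ℝ (sdist Ω) U ∧
    ∀ x ∈ frontier Ω, ∃ i, pd i (sdist Ω) x ≠ 0

/-- `Ω` has a smooth boundary: the signed distance function is smooth and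
noncritical on a neighborhood of the boundary. -/
def SmoothBoundary (Ω : Set E3) : Prop :=
  ∃ U : Set E3, IsOpen U ∧ frontier Ω ⊆ U ∧ ContDiffOn ℝ (⊤ : ℕ∞) (sdist Ω) U ∧
    ∀ x ∈ frontier Ω, ∃ i, pd i (sdist Ω) x ≠ 0

/-- The first-order operator with coefficients `b`. -/
def vecOp (b : Fin 3 → E3 → ℝ) (f : E3 → ℝ) : E3 → ℝ :=
  fun x => ∑ i, b i x * pd i f x

/-- Iterated application of a triple of operators along a list of indices. -/
def opList (T : Fin 3 → (E3 → ℝ) → (E3 → ℝ)) :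
    List (Fin 3) → (E3 → ℝ) → (E3 → ℝ)
  | [], f => f
  | i :: l, f => T i (opList T l f)

/-- Componentwise iterated application to a vector field. -/
def opListV (T : Fin 3 → (E3 → ℝ) → (E3 → ℝ)) (β : List (Fin 3))
    (v : E3 → Fin 3 → ℝ) : E3 → Fin 3 → ℝ :=
  fun x m => opList T β (fun y => v y m) x

/-- Divergence of a vector field. -/
def div3 (v : E3 → Fin 3 → ℝ) : E3 → ℝ :=
  fun x => ∑ i, pd i (fun y => v y i) x

/-- Curl of a vector field. -/
def curl3 (v : E3 → Fin 3 → ℝ) : E3 → Fin 3 → ℝ :=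
  fun x => ![pd 1 (fun y => v y 2) x - pd 2 (fun y => v y 1) x,
             pd 2 (fun y => v y 0) x - pd 0 (fun y => v y 2) x,
             pd 0 (fun y => v y 1) x - pd 1 (fun y => v y 0) x]

/-- Gradient of a scalar function, as a vector field. -/
def grad3 (f : E3 → ℝ) : E3 → Fin 3 → ℝ := fun x i => pd i f x

/-- A complete system of tangential analytic vector fields `T₁,T₂,T₃`
(with coefficients `b j`), together with an additional analytic field `X₀`
(with coefficients `bX`), such that the `T_j` are tangential to `∂Ω`,
the coefficients have uniform analyticity bounds on the closure of `Ω`,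
and near the boundary the fields span all partial derivatives. -/
structure TangSystem (Ω : Set E3) where
  b : Fin 3 → Fin 3 → E3 → ℝ
  bX : Fin 3 → E3 → ℝ
  Cb : ℝ
  Cb_pos : 0 < Cb
  analytic_b : ∀ j i : Fin 3, ∀ l : List (Fin 3), ∀ x ∈ closure Ω,
    |pdList l (b j i) x| ≤ Cb ^ (l.length + 1) * (Nat.factorial l.length : ℝ)
  analytic_bX : ∀ i : Fin 3, ∀ l : List (Fin 3), ∀ x ∈ closure Ω,
    |pdList l (bX i) x| ≤ Cb ^ (l.length + 1) * (Nat.factorial l.length : ℝ)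
  tangential : ∀ j : Fin 3, ∀ x ∈ frontier Ω, vecOp (b j) (sdist Ω) x = 0
  η₀ : ℝ
  η₀_pos : 0 < η₀
  ξ : Fin 3 → E3 → ℝ
  ηc : Fin 3 → Fin 3 → E3 → ℝ
  span : ∀ k : Fin 3, ∀ f : E3 → ℝ, ∀ x ∈ closure Ω, sdist Ω x ≤ η₀ →
    pd k f x = ξ k x * vecOp bX f x + ∑ j, ηc j k x * vecOp (b j) f x

/-- The tangential fields of a tangential system, as operators. -/
def Tfields {Ω : Set E3} (S : TangSystem Ω) : Fin 3 → (E3 → ℝ) → (E3 → ℝ) :=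
  fun j => vecOp (S.b j)

/-- `ε` times the time derivative. -/
def tder (ε : ℝ) (f : ℝ → E3 → ℝ) : ℝ → E3 → ℝ :=
  fun t x => ε * deriv (fun s => f s x) t

/-- `(ε ∂_t)^i f` evaluated at time `t`, a spatial scalar function. -/
def st (ε : ℝ) (i : ℕ) (f : ℝ → E3 → ℝ) (t : ℝ) : E3 → ℝ :=
  (tder ε)^[i] f t

/-- `(ε ∂_t)^i v` evaluated at time `t`, a spatial vector field. -/
def vt (ε : ℝ) (i : ℕ) (v : ℝ → E3 → Fin 3 → ℝ) (t : ℝ) : E3 → Fin 3 → ℝ :=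
  fun x m => (tder ε)^[i] (fun s y => v s y m) t x

/-- The `L²` norm `‖∂_x^j T^k f‖_{L²(Ω)}` (sum over all order-`j` spatial
derivatives and all `k`-fold compositions of the tangential fields). -/
def DTnorm (Ω : Set E3) (T : Fin 3 → (E3 → ℝ) → (E3 → ℝ)) (j k : ℕ)
    (f : E3 → ℝ) : ℝ :=
  ∑ ι : Fin j → Fin 3, ∑ β : Fin k → Fin 3,
    L2 Ω (pdList (List.ofFn ι) (opList T (List.ofFn β) f))

/-- Vector-field version of `DTnorm`. -/
def DTnormV (Ω : Set E3) (T : Fin 3 → (E3 → ℝ) → (E3 → ℝ)) (j k : ℕ)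
    (w : E3 → Fin 3 → ℝ) : ℝ :=
  ∑ m : Fin 3, DTnorm Ω T j k (fun x => w x m)

/-- Sup norm on a set. -/
def supOn (s : Set E3) (f : E3 → ℝ) : ℝ := ⨆ x ∈ s, |f x|

/-- The `L^∞` norm `‖∂_x^j T^k f‖_{L^∞(s)}`. -/
def DTnormSup (s : Set E3) (T : Fin 3 → (E3 → ℝ) → (E3 → ℝ)) (j k : ℕ)
    (f : E3 → ℝ) : ℝ :=
  ∑ ι : Fin j → Fin 3, ∑ β : Fin k → Fin 3,
    supOn s (pdList (List.ofFn ι) (opList T (List.ofFn β) f))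

/-- The commutator `[T^β, div]` applied to a vector field. -/
def commDiv (T : Fin 3 → (E3 → ℝ) → (E3 → ℝ)) (β : List (Fin 3))
    (w : E3 → Fin 3 → ℝ) : E3 → ℝ :=
  fun x => opList T β (div3 w) x - div3 (opListV T β w) x

/-- The commutator `[T^β, curl]` applied to a vector field. -/
def commCurl (T : Fin 3 → (E3 → ℝ) → (E3 → ℝ)) (β : List (Fin 3))
    (w : E3 → Fin 3 → ℝ) : E3 → Fin 3 → ℝ :=
  fun x m => opList T β (fun y => curl3 w y m) x - curl3 (opListV T β w) x m

/-- The commutator `[T^β, ∇]` applied to a scalar function. -/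
def commGrad (T : Fin 3 → (E3 → ℝ) → (E3 → ℝ)) (β : List (Fin 3))
    (f : E3 → ℝ) : E3 → Fin 3 → ℝ :=
  fun x m => opList T β (pd m f) x - pd m (opList T β f) x

/-- The commutator `[T_a, ∂^ι]` applied to a scalar function. -/
def commTD (T : Fin 3 → (E3 → ℝ) → (E3 → ℝ)) (a : Fin 3) (ι : List (Fin 3))
    (f : E3 → ℝ) : E3 → ℝ :=
  fun x => T a (pdList ι f) x - pdList ι (T a f) x

/-- The commutator `[∂^ι, T_a]` applied to a scalar function. -/
def commDT (T : Fin 3 → (E3 → ℝ) → (E3 → ℝ)) (ι : List (Fin 3)) (a : Fin 3)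
    (f : E3 → ℝ) : E3 → ℝ :=
  fun x => pdList ι (T a f) x - T a (pdList ι f) x

/-- The analytic norm `‖f‖_{A(τ)}` with parameters `κ, κ̄`:
`Σ_{(j,k,i)} κ^{(j−1)₊} κ̄^k τ^{(j+k+i−3)₊}/(j+k+i−3)! ‖∂_x^j T^k (ε∂_t)^i f‖_{L²(Ω)}`
(recall `n! = 1` for `n < 0`, which is implemented by truncated subtraction). -/
def Anorm (Ω : Set E3) (T : Fin 3 → (E3 → ℝ) → (E3 → ℝ)) (ε κ κb τ : ℝ)
    (f : ℝ → E3 → ℝ) (t : ℝ) : ℝ :=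
  ∑' p : ℕ × ℕ × ℕ,
    κ ^ (p.1 - 1) * κb ^ p.2.1 * τ ^ (p.1 + p.2.1 + p.2.2 - 3) /
      (Nat.factorial (p.1 + p.2.1 + p.2.2 - 3) : ℝ) *
      DTnorm Ω T p.1 p.2.1 (st ε p.2.2 f t)

/-- The analytic norm `‖f‖_{B(τ)}`:
`Σ_{(j,k,i)} κ^j κ̄^k τ^{(j+k+i−2)₊}/(j+k+i−2)! ‖∂_x^j T^k (ε∂_t)^i f‖_{L²(Ω)}`. -/
def Bnorm (Ω : Set E3) (T : Fin 3 → (E3 → ℝ) → (E3 → ℝ)) (ε κ κb τ : ℝ)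
    (f : ℝ → E3 → ℝ) (t : ℝ) : ℝ :=
  ∑' p : ℕ × ℕ × ℕ,
    κ ^ p.1 * κb ^ p.2.1 * τ ^ (p.1 + p.2.1 + p.2.2 - 2) /
      (Nat.factorial (p.1 + p.2.1 + p.2.2 - 2) : ℝ) *
      DTnorm Ω T p.1 p.2.1 (st ε p.2.2 f t)

/-- The norm `‖f‖_Y = sup_{j+k+i ≤ 4} ‖∂_x^j T^k (ε∂_t)^i f‖_{L²(Ω)}`. -/
def Ynorm (Ω : Set E3) (T : Fin 3 → (E3 → ℝ) → (E3 → ℝ)) (ε : ℝ)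
    (f : ℝ → E3 → ℝ) (t : ℝ) : ℝ :=
  ⨆ p : ℕ × ℕ × ℕ,
    if p.1 + p.2.1 + p.2.2 ≤ 4 then DTnorm Ω T p.1 p.2.1 (st ε p.2.2 f t) else 0

/-- `A(τ)`-norm of a (time-dependent) vector field. -/
def AnormV (Ω : Set E3) (T : Fin 3 → (E3 → ℝ) → (E3 → ℝ)) (ε κ κb τ : ℝ)
    (v : ℝ → E3 → Fin 3 → ℝ) (t : ℝ) : ℝ :=
  ∑ m : Fin 3, Anorm Ω T ε κ κb τ (fun s x => v s x m) t

/-- `B(τ)`-norm of a (time-dependent) vector field. -/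
def BnormV (Ω : Set E3) (T : Fin 3 → (E3 → ℝ) → (E3 → ℝ)) (ε κ κb τ : ℝ)
    (v : ℝ → E3 → Fin 3 → ℝ) (t : ℝ) : ℝ :=
  ∑ m : Fin 3, Bnorm Ω T ε κ κb τ (fun s x => v s x m) t

/-- `Y`-norm of a (time-dependent) vector field. -/
def YnormV (Ω : Set E3) (T : Fin 3 → (E3 → ℝ) → (E3 → ℝ)) (ε : ℝ)
    (v : ℝ → E3 → Fin 3 → ℝ) (t : ℝ) : ℝ :=
  ∑ m : Fin 3, Ynorm Ω T ε (fun s x => v s x m) t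

/-- The spatial analytic norm `‖f‖_{X(δ)} = Σ_j δ^{(j−3)₊}/(j−3)! ‖∂_x^j f‖_{L²(Ω)}`. -/
def Xnorm (Ω : Set E3) (δ : ℝ) (f : E3 → ℝ) : ℝ :=
  ∑' j : ℕ, δ ^ (j - 3) / (Nat.factorial (j - 3) : ℝ) * DnormL2 Ω j f

/-- `X(δ)`-norm of a vector field. -/
def XnormV (Ω : Set E3) (δ : ℝ) (v : E3 → Fin 3 → ℝ) : ℝ :=
  ∑ m : Fin 3, Xnorm Ω δ (fun x => v x m)

/-- `(p, v, S)` is a smooth solution on `[0, T₀]` of the symmetrized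
non-isentropic compressible Euler system with Mach number `ε`,
coefficients `a = f₁(S) g₁(εu)`, `r = f₂(S) g₂(εu)`, and impermeability
boundary condition `v·ν = 0` on `∂Ω`. -/
structure EulerSol (Ω : Set E3) (ε : ℝ) (f₁ f₂ : ℝ → ℝ)
    (g₁ g₂ : ℝ → (Fin 3 → ℝ) → ℝ) (p : ℝ → E3 → ℝ)
    (v : ℝ → E3 → Fin 3 → ℝ) (S : ℝ → E3 → ℝ) (T₀ : ℝ) : Prop where
  smooth_p : ContDiff ℝ (⊤ : ℕ∞) (fun q : ℝ × E3 => p q.1 q.2)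
  smooth_v : ∀ m : Fin 3, ContDiff ℝ (⊤ : ℕ∞) (fun q : ℝ × E3 => v q.1 q.2 m)
  smooth_S : ContDiff ℝ (⊤ : ℕ∞) (fun q : ℝ × E3 => S q.1 q.2)
  eq_p : ∀ t ∈ Set.Icc (0 : ℝ) T₀, ∀ x ∈ Ω,
    f₁ (S t x) * g₁ (ε * p t x) (fun i => ε * v t x i) *
        (deriv (fun s => p s x) t + ∑ i, v t x i * pd i (p t) x) +
      ε⁻¹ * div3 (v t) x = 0
  eq_v : ∀ t ∈ Set.Icc (0 : ℝ) T₀, ∀ x ∈ Ω, ∀ m : Fin 3,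
    f₂ (S t x) * g₂ (ε * p t x) (fun i => ε * v t x i) *
        (deriv (fun s => v s x m) t + ∑ i, v t x i * pd i (fun y => v t y m) x) +
      ε⁻¹ * pd m (p t) x = 0
  eq_S : ∀ t ∈ Set.Icc (0 : ℝ) T₀, ∀ x ∈ Ω,
    deriv (fun s => S s x) t + ∑ i, v t x i * pd i (S t) x = 0
  bc : ∀ t ∈ Set.Icc (0 : ℝ) T₀, ∀ x ∈ frontier Ω,
    ∑ i, v t x i * nuv Ω x i = 0

/-- Bound `M₀` on the `H⁵` norm of the initial data. -/
def H5bound (Ω : Set E3) (M₀ : ℝ) (p₀ : E3 → ℝ) (v₀ : E3 → Fin 3 → ℝ)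
    (S₀ : E3 → ℝ) : Prop :=
  HnormL2 Ω 5 p₀ + HnormL2v Ω 5 v₀ + HnormL2 Ω 5 S₀ ≤ M₀

/-- The analytic bound on the initial data:
`Σ_j τ₀^{(j−3)₊}/(j−3)! ‖∂_x^j (p₀,v₀,S₀)‖_{L²(Ω)} ≤ M₀`. -/
def AnalyticInit (Ω : Set E3) (τ₀ M₀ : ℝ) (p₀ : E3 → ℝ)
    (v₀ : E3 → Fin 3 → ℝ) (S₀ : E3 → ℝ) : Prop :=
  ∑' j : ℕ, τ₀ ^ (j - 3) / (Nat.factorial (j - 3) : ℝ) *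
    (DnormL2 Ω j p₀ + DnormL2v Ω j v₀ + DnormL2 Ω j S₀) ≤ M₀

/-- Compatibility conditions of all orders: all time derivatives of the
velocity at `t = 0` are tangential at the boundary. -/
def CompatAll (Ω : Set E3) (v : ℝ → E3 → Fin 3 → ℝ) : Prop :=
  ∀ k : ℕ, ∀ x ∈ frontier Ω,
    ∑ i, iteratedDeriv k (fun s => v s x i) 0 * nuv Ω x i = 0

/-- `M_{ε,κ,κ̄}(t) = sup_{s∈[0,t]} (‖S(s)‖_{A(τ(s))} + ‖u(s)‖_{A(τ(s))})`
with `τ(s) = τ₀ − K s` and `u = (p, v)`. -/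
def Mnorm (Ω : Set E3) (T : Fin 3 → (E3 → ℝ) → (E3 → ℝ)) (ε κ κb τ0 K : ℝ)
    (p : ℝ → E3 → ℝ) (v : ℝ → E3 → Fin 3 → ℝ) (S : ℝ → E3 → ℝ) (t : ℝ) : ℝ :=
  ⨆ s ∈ Set.Icc (0 : ℝ) t,
    (Anorm Ω T ε κ κb (τ0 - K * s) S s + Anorm Ω T ε κ κb (τ0 - K * s) p s +
      AnormV Ω T ε κ κb (τ0 - K * s) v s)


section Calculus

variable {f g : E3 → ℝ} {i : Fin 3}

theorem ContDiff.differentiable_of_smooth (hf : ContDiff ℝ (⊤ : ℕ∞) f) : Differentiable ℝ f :=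
  hf.differentiable (by simp)

theorem contDiff_pd (i : Fin 3) (hf : ContDiff ℝ (⊤ : ℕ∞) f) : ContDiff ℝ (⊤ : ℕ∞) (pd i f) := by
  unfold pd
  exact (hf.fderiv_right (m := (⊤ : ℕ∞)) (by simp)).clm_apply contDiff_const

theorem continuous_pd (i : Fin 3) (hf : ContDiff ℝ (⊤ : ℕ∞) f) : Continuous (pd i f) :=
  (contDiff_pd i hf).continuous

theorem hasCompactSupport_pd (i : Fin 3) (hf : HasCompactSupport f) :
    HasCompactSupport (pd i f) :=
  hf.fderiv_apply ℝ _

theorem pd_mul {x : E3} (hf : DifferentiableAt ℝ f x) (hg : DifferentiableAt ℝ g x) :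
    pd i (fun y => f y * g y) x = pd i f x * g x + f x * pd i g x := by
  simp only [pd]
  rw [fderiv_fun_mul hf hg]
  simp
  ring

theorem pd_sub {x : E3} (hf : DifferentiableAt ℝ f x) (hg : DifferentiableAt ℝ g x) :
    pd i (fun y => f y - g y) x = pd i f x - pd i g x := by
  simp only [pd]
  rw [fderiv_fun_sub hf hg]
  simp

theorem pd_add {x : E3} (hf : DifferentiableAt ℝ f x) (hg : DifferentiableAt ℝ g x) :
    pd i (fun y => f y + g y) x = pd i f x + pd i g x := by
  simp only [pd]
  rw [fderiv_fun_add hf hg]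
  simp

theorem pd_sum {ι : Type*} (s : Finset ι) {F : ι → E3 → ℝ} {x : E3}
    (hF : ∀ k ∈ s, DifferentiableAt ℝ (F k) x) :
    pd i (fun y => ∑ k ∈ s, F k y) x = ∑ k ∈ s, pd i (F k) x := by
  simp only [pd]
  rw [fderiv_fun_sum hF]
  simp

theorem pd_congr_of_eventuallyEq {x : E3} (h : f =ᶠ[nhds x] g) : pd i f x = pd i g x := by
  simp only [pd, h.fderiv_eq]

theorem pd_comm (i j : Fin 3) (hf : ContDiff ℝ (⊤ : ℕ∞) f) (x : E3) :
    pd i (pd j f) x = pd j (pd i f) x := by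
  have hd : DifferentiableAt ℝ (fderiv ℝ f) x :=
    (hf.fderiv_right (m := (⊤ : ℕ∞)) (by simp)).differentiable (by simp) x
  have key : ∀ k l : Fin 3, pd k (pd l f) x =
      fderiv ℝ (fderiv ℝ f) x (EuclideanSpace.single k 1) (EuclideanSpace.single l 1) := by
    intro k l
    unfold pd
    rw [fderiv_clm_apply hd (differentiableAt_const _)]
    simp
  rw [key, key]
  exact (hf.contDiffAt.isSymmSndFDerivAt (by
    rw [minSmoothness_of_isRCLikeNormedField]
    exact WithTop.coe_le_coe.2 (le_top : (2 : ℕ∞) ≤ ⊤))) _ _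

theorem integral_pd_eq_zero (i : Fin 3) (hf : ContDiff ℝ (⊤ : ℕ∞) f) (hc : HasCompactSupport f) :
    ∫ x, pd i f x = 0 := by
  have h := integral_mul_fderiv_eq_neg_fderiv_mul_of_integrable (μ := (volume : Measure E3))
    (f := fun _ => (1 : ℝ)) (g := f) (v := EuclideanSpace.single i 1)
    (by simp) (by simp only [one_mul]; exact
      (continuous_pd i hf).integrable_of_hasCompactSupport (hasCompactSupport_pd i hc))
    (by simpa using hf.continuous.integrable_of_hasCompactSupport hc)
    (fun x _ => differentiableAt_const _) (fun x _ => hf.differentiable_of_smooth x)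
  simpa [pd] using h

end Calculus

section SignedDistance

variable {Ω : Set E3}

theorem continuous_sdist (Ω : Set E3) : Continuous (sdist Ω) :=
  (Metric.continuous_infDist_pt _).sub (Metric.continuous_infDist_pt _)

theorem ExteriorDomain.compl_nonempty (hΩ : ExteriorDomain Ω) : Ωᶜ.Nonempty := by
  obtain ⟨x, hx⟩ := hΩ.bdry_nonempty
  rw [hΩ.isOpen.frontier_eq] at hx
  exact ⟨x, hx.2⟩

theorem ExteriorDomain.nonempty (hΩ : ExteriorDomain Ω) : Ω.Nonempty := by
  obtain ⟨x, hx⟩ := hΩ.bdry_nonempty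
  exact closure_nonempty_iff.1 ⟨x, hx.1⟩

theorem ExteriorDomain.isCompact_frontier (hΩ : ExteriorDomain Ω) : IsCompact (frontier Ω) :=
  hΩ.compl_compact.of_isClosed_subset isClosed_frontier
    (by rw [hΩ.isOpen.frontier_eq]; exact fun x hx => hx.2)

theorem sdist_of_mem {x : E3} (hx : x ∈ Ω) : sdist Ω x = Metric.infDist x Ωᶜ := by
  simp [sdist, Metric.infDist_zero_of_mem hx]

theorem sdist_of_notMem {x : E3} (hx : x ∉ Ω) : sdist Ω x = -Metric.infDist x Ω := by
  simp [sdist, Metric.infDist_zero_of_mem (show x ∈ Ωᶜ from hx)]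

theorem ExteriorDomain.sdist_pos_iff (hΩ : ExteriorDomain Ω) {x : E3} :
    0 < sdist Ω x ↔ x ∈ Ω := by
  constructor
  · intro h
    by_contra hx
    rw [sdist_of_notMem hx] at h
    linarith [Metric.infDist_nonneg (x := x) (s := Ω)]
  · intro hx
    rw [sdist_of_mem hx]
    exact (hΩ.isOpen.isClosed_compl.notMem_iff_infDist_pos hΩ.compl_nonempty).1 (by simpa using hx)

theorem ExteriorDomain.sdist_eq_zero_iff (hΩ : ExteriorDomain Ω) {x : E3} :
    sdist Ω x = 0 ↔ x ∈ frontier Ω := by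
  rw [hΩ.isOpen.frontier_eq]
  constructor
  · intro h
    have hx : x ∉ Ω := fun hx => (hΩ.sdist_pos_iff.2 hx).ne' h
    rw [sdist_of_notMem hx] at h
    exact ⟨(Metric.mem_closure_iff_infDist_zero hΩ.nonempty).2 (by linarith), hx⟩
  · rintro ⟨hc, hx⟩
    rw [sdist_of_notMem hx, (Metric.mem_closure_iff_infDist_zero hΩ.nonempty).1 hc, neg_zero]

theorem ExteriorDomain.exists_frontier_dist_eq (hΩ : ExteriorDomain Ω) {x : E3}
    (hx : 0 ≤ sdist Ω x) : ∃ y ∈ frontier Ω, dist x y = sdist Ω x := by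
  rcases hx.eq_or_lt with h | h
  · exact ⟨x, hΩ.sdist_eq_zero_iff.1 h.symm, by simp [← h]⟩
  · have hx := hΩ.sdist_pos_iff.1 h
    obtain ⟨y, hy, hxy⟩ := exists_mem_frontier_infDist_compl_eq_dist hx
      (fun h => by simpa [h] using hΩ.compl_nonempty)
    exact ⟨y, hy, by rw [sdist_of_mem hx, hxy]⟩

/-- Near the boundary the gradient of the signed distance extends to a smooth compactly supported
field `N`, which admits a smooth compactly supported transversal field `Z`. -/
theorem ExteriorDomain.exists_normal_fields (hΩ : ExteriorDomain Ω) (hb : AnalyticBoundary Ω) :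
    ∃ (N Z : Fin 3 → E3 → ℝ) (δ : ℝ), 0 < δ ∧
      (∀ j, ContDiff ℝ (⊤ : ℕ∞) (N j)) ∧ (∀ j, ContDiff ℝ (⊤ : ℕ∞) (Z j)) ∧
      (∀ j, HasCompactSupport (Z j)) ∧
      ∀ x, 0 ≤ sdist Ω x → sdist Ω x < δ → ContDiffAt ℝ (⊤ : ℕ∞) (sdist Ω) x ∧
        (∀ j, pd j (sdist Ω) x = N j x) ∧ ∑ j, N j x * Z j x = 1 := by
  obtain ⟨U, hU, hfU, hd, hne⟩ := hb
  have hsm : ∀ x ∈ U, ContDiffAt ℝ (⊤ : ℕ∞) (sdist Ω) x := fun x hx => (hd x hx).contDiffAt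
  have hpd : ∀ j, ∀ x ∈ U, ContDiffAt ℝ (⊤ : ℕ∞) (pd j (sdist Ω)) x := by
    intro j x hx
    unfold pd
    exact ((hsm x hx).fderiv_right (m := (⊤ : ℕ∞)) (by simp)).clm_apply contDiffAt_const
  have hq : ∀ x ∈ U, ContDiffAt ℝ (⊤ : ℕ∞) (fun y => ∑ j, pd j (sdist Ω) y ^ 2) x :=
    fun x hx => ContDiffAt.sum fun j _ => (hpd j x hx).pow 2
  let V : Set E3 := U ∩ (fun y => ∑ j, pd j (sdist Ω) y ^ 2) ⁻¹' {0}ᶜ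
  have hV : IsOpen V := ContinuousOn.isOpen_inter_preimage
    (fun x hx => (hq x hx).continuousAt.continuousWithinAt) hU isOpen_compl_singleton
  have hfV : frontier Ω ⊆ V := by
    intro x hx
    refine ⟨hfU hx, fun h0 => ?_⟩
    obtain ⟨i, hi⟩ := hne x hx
    have h0 : ∑ j, pd j (sdist Ω) x ^ 2 = 0 := h0
    rw [Finset.sum_eq_zero_iff_of_nonneg (fun _ _ => sq_nonneg _)] at h0
    exact hi (by simpa using h0 i (Finset.mem_univ i))
  obtain ⟨K, hK, hfK, hKV⟩ := exists_compact_between hΩ.isCompact_frontier hV hfV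
  obtain ⟨η, hη1, hη0, -⟩ := exists_contMDiffMap_one_nhds_of_subset_interior
    (n := (⊤ : ℕ∞)) (modelWithCornersSelf ℝ E3) isClosed_frontier hfK
  have hηs : ContDiff ℝ (⊤ : ℕ∞) (fun x => η x) := η.contMDiff.contDiff
  have hcut : ∀ w : E3 → ℝ, (∀ x ∈ V, ContDiffAt ℝ (⊤ : ℕ∞) w x) →
      ContDiff ℝ (⊤ : ℕ∞) (fun x => η x * w x) := by
    intro w hw
    rw [contDiff_iff_contDiffAt]
    intro x
    by_cases hx : x ∈ V
    · exact hηs.contDiffAt.mul (hw x hx)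
    · refine (contDiffAt_const (c := (0 : ℝ))).congr_of_eventuallyEq ?_
      filter_upwards [hK.isClosed.isOpen_compl.mem_nhds (fun h => hx (hKV h))] with y hy
      rw [hη0 y hy, zero_mul]
  obtain ⟨W, hW, hfW, hW1⟩ := eventually_nhdsSet_iff_exists.1 hη1
  obtain ⟨δ, hδ, hδW⟩ := hΩ.isCompact_frontier.exists_thickening_subset_open
    (hW.inter hV) (Set.subset_inter hfW hfV)
  refine ⟨fun j x => η x * pd j (sdist Ω) x,
    fun j x => η x * (pd j (sdist Ω) x * (∑ k, pd k (sdist Ω) x ^ 2)⁻¹), δ, hδ,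
    fun j => hcut _ fun x hx => hpd j x hx.1,
    fun j => hcut _ fun x hx => (hpd j x hx.1).mul ((hq x hx.1).inv hx.2),
    fun j => HasCompactSupport.intro hK fun x hx => by simp [hη0 x hx], ?_⟩
  intro x hx0 hxδ
  obtain ⟨y, hy, hxy⟩ := hΩ.exists_frontier_dist_eq hx0
  obtain ⟨hxW, hxV⟩ := hδW (Metric.mem_thickening_iff.2 ⟨y, hy, hxy ▸ hxδ⟩)
  have h1 : η x = 1 := hW1 x hxW
  have h0 : ∑ k, pd k (sdist Ω) x ^ 2 ≠ 0 := hxV.2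
  refine ⟨hsm x hxV.1, fun j => by simp [h1], ?_⟩
  simp only [h1, one_mul, ← mul_assoc, ← pow_two]
  rw [← Finset.sum_mul, mul_inv_cancel₀ h0]

end SignedDistance

section DivergenceTheorem

variable {Ω : Set E3}

theorem deriv_smoothTransition_eq_zero {s : ℝ} (hs : s ≤ 0 ∨ 1 ≤ s) :
    deriv Real.smoothTransition s = 0 := by
  rcases hs with hs | hs
  · refine IsLocalMin.deriv_eq_zero (Filter.Eventually.of_forall fun t => ?_)
    rw [Real.smoothTransition.zero_of_nonpos hs]
    exact Real.smoothTransition.nonneg t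
  · refine IsLocalMax.deriv_eq_zero (Filter.Eventually.of_forall fun t => ?_)
    rw [Real.smoothTransition.one_of_one_le hs]
    exact Real.smoothTransition.le_one t

theorem exists_bound_deriv_smoothTransition :
    ∃ M : ℝ, ∀ s, |deriv Real.smoothTransition s| ≤ M := by
  have hc : HasCompactSupport (deriv Real.smoothTransition) :=
    HasCompactSupport.intro (isCompact_Icc (a := (0 : ℝ)) (b := 1)) fun s hs =>
      deriv_smoothTransition_eq_zero <| by
        by_contra! h
        exact hs ⟨h.1.le, h.2.le⟩
  exact hc.exists_bound_of_continuous
    ((Real.smoothTransition.contDiff (n := (1 : ℕ∞))).continuous_deriv (by simp))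

/-- Smooth cutoffs `h (r d)` of the domain, for `r` large. -/
theorem contDiff_smoothTransition_sdist {δ r : ℝ} (hδ : 0 < δ) (hr : 1 < r * δ)
    (hd : ∀ x, 0 ≤ sdist Ω x → sdist Ω x < δ → ContDiffAt ℝ (⊤ : ℕ∞) (sdist Ω) x) :
    ContDiff ℝ (⊤ : ℕ∞) (fun x => Real.smoothTransition (r * sdist Ω x)) := by
  have hr0 : 0 < r := by
    by_contra! h
    nlinarith
  rw [contDiff_iff_contDiffAt]
  intro x
  rcases lt_or_ge (sdist Ω x) 0 with h | h
  · refine (contDiffAt_const (c := (0 : ℝ))).congr_of_eventuallyEq ?_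
    filter_upwards [(continuous_sdist Ω).continuousAt.eventually_lt continuousAt_const h] with y hy
    exact Real.smoothTransition.zero_of_nonpos (by nlinarith)
  rcases lt_or_ge (sdist Ω x) δ with h' | h'
  · exact Real.smoothTransition.contDiffAt.comp x (contDiffAt_const.mul (hd x h h'))
  · refine (contDiffAt_const (c := (1 : ℝ))).congr_of_eventuallyEq ?_
    have : 1 < r * sdist Ω x := by nlinarith
    filter_upwards [continuousAt_const.eventually_lt
      (continuous_const.mul (continuous_sdist Ω)).continuousAt this] with y hy
    exact Real.smoothTransition.one_of_one_le hy.le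

theorem pd_smoothTransition_sdist {δ r : ℝ} {N : Fin 3 → E3 → ℝ} (hδ : 0 < δ) (hr : 1 < r * δ)
    (hd : ∀ x, 0 ≤ sdist Ω x → sdist Ω x < δ → ContDiffAt ℝ (⊤ : ℕ∞) (sdist Ω) x)
    (hN : ∀ x, 0 ≤ sdist Ω x → sdist Ω x < δ → ∀ j, pd j (sdist Ω) x = N j x)
    (j : Fin 3) (x : E3) :
    pd j (fun x => Real.smoothTransition (r * sdist Ω x)) x =
      r * deriv Real.smoothTransition (r * sdist Ω x) * N j x := by
  have hr0 : 0 < r := by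
    by_contra! h
    nlinarith
  by_cases hx : 0 ≤ sdist Ω x ∧ sdist Ω x < δ
  · have h1 : HasFDerivAt (sdist Ω) (fderiv ℝ (sdist Ω) x) x :=
      ((hd x hx.1 hx.2).differentiableAt (by simp)).hasFDerivAt
    have h2 : HasDerivAt Real.smoothTransition (deriv Real.smoothTransition (r * sdist Ω x))
        (r * sdist Ω x) :=
      ((Real.smoothTransition.contDiff (n := (1 : ℕ∞))).differentiable (by simp) _).hasDerivAt
    have h3 := h2.comp_hasFDerivAt x (h1.const_mul r)
    have h4 : pd j (fun x => Real.smoothTransition (r * sdist Ω x)) x =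
        deriv Real.smoothTransition (r * sdist Ω x) * (r * pd j (sdist Ω) x) := by
      unfold pd
      rw [show (fun x => Real.smoothTransition (r * sdist Ω x)) =
        Real.smoothTransition ∘ (fun x => r * sdist Ω x) from rfl, h3.fderiv]
      simp
    rw [h4, hN x hx.1 hx.2 j]
    ring
  · have hs : r * sdist Ω x ≤ 0 ∨ 1 ≤ r * sdist Ω x := by
      by_contra! h
      exact hx ⟨(pos_of_mul_pos_right h.1 hr0.le).le, by nlinarith⟩
    rw [deriv_smoothTransition_eq_zero hs, mul_zero, zero_mul]
    have h0 : fderiv ℝ (fun x => Real.smoothTransition (r * sdist Ω x)) x = 0 := by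
      rcases hs with hs | hs
      · refine IsLocalMin.fderiv_eq_zero (Filter.Eventually.of_forall fun t => ?_)
        simp only
        rw [Real.smoothTransition.zero_of_nonpos hs]
        exact Real.smoothTransition.nonneg _
      · refine IsLocalMax.fderiv_eq_zero (Filter.Eventually.of_forall fun t => ?_)
        simp only
        rw [Real.smoothTransition.one_of_one_le hs]
        exact Real.smoothTransition.le_one _
    simp [pd, h0]

theorem eventually_one_lt_mul {δ : ℝ} (hδ : 0 < δ) :
    ∀ᶠ n : ℕ in Filter.atTop, 1 < (n : ℝ) * δ :=
  (tendsto_natCast_atTop_atTop.atTop_mul_const hδ).eventually_gt_atTop 1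

/-- The divergence theorem for compactly supported tangential fields. -/
theorem ExteriorDomain.integral_div_eq_zero_of_hasCompactSupport (hΩ : ExteriorDomain Ω)
    (hb : AnalyticBoundary Ω) {F : Fin 3 → E3 → ℝ} (hF : ∀ i, ContDiff ℝ (⊤ : ℕ∞) (F i))
    (hc : ∀ i, HasCompactSupport (F i))
    (htan : ∀ x ∈ frontier Ω, ∑ i, F i x * pd i (sdist Ω) x = 0) :
    ∫ x in Ω, ∑ i, pd i (F i) x = 0 := by
  obtain ⟨N, Z, δ, hδ, hN, -, -, hnear⟩ := hΩ.exists_normal_fields hb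
  have hd := fun x h h' => (hnear x h h').1
  have hdN := fun x h h' => (hnear x h h').2.1
  obtain ⟨M, hM⟩ := exists_bound_deriv_smoothTransition
  let K : Set E3 := ⋃ i, tsupport (F i)
  have hK : IsCompact K := isCompact_iUnion fun i => (hc i).isCompact
  have hFK : ∀ x ∉ K, ∀ i, F i x = 0 := fun x hx i =>
    image_eq_zero_of_notMem_tsupport fun h => hx (Set.mem_iUnion.2 ⟨i, h⟩)
  let G : E3 → ℝ := fun x => ∑ i, F i x * N i x
  have hG : ContDiff ℝ (⊤ : ℕ∞) G := ContDiff.sum fun i _ => (hF i).mul (hN i)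
  have hGc : HasCompactSupport G := HasCompactSupport.intro hK fun x hx => by
    simp [G, hFK x hx]
  obtain ⟨L, hL⟩ := hG.lipschitzWith_of_hasCompactSupport hGc (by simp)
  have hGd : ∀ x, 0 ≤ sdist Ω x → |G x| ≤ L * sdist Ω x := by
    intro x hx
    obtain ⟨y, hy, hxy⟩ := hΩ.exists_frontier_dist_eq hx
    have hy0 : sdist Ω y = 0 := hΩ.sdist_eq_zero_iff.2 hy
    have hGy : G y = 0 := by
      rw [← htan y hy]
      exact Finset.sum_congr rfl fun i _ => by rw [hdN y hy0.ge (hy0 ▸ hδ) i]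
    have := hL.dist_le_mul x y
    rwa [hGy, hxy, Real.dist_0_eq_abs] at this
  let φ : ℕ → E3 → ℝ := fun n x => Real.smoothTransition (n * sdist Ω x)
  let B : ℕ → E3 → ℝ := fun n x => n * deriv Real.smoothTransition (n * sdist Ω x) * G x
  have hdiv_cont : Continuous fun x => ∑ i, pd i (F i) x :=
    continuous_finsetSum _ fun i _ => continuous_pd i (hF i)
  have hdiv_int : Integrable fun x => ∑ i, pd i (F i) x := integrable_finsetSum _ fun i _ =>
    (continuous_pd i (hF i)).integrable_of_hasCompactSupport (hasCompactSupport_pd i (hc i))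
  have hφ_cont : ∀ n, Continuous (φ n) := fun n =>
    Real.smoothTransition.continuous.comp (continuous_const.mul (continuous_sdist Ω))
  have hB_cont : ∀ n, Continuous (B n) := fun n =>
    (continuous_const.mul (((Real.smoothTransition.contDiff (n := (1 : ℕ∞))).continuous_deriv
      (by simp)).comp (continuous_const.mul (continuous_sdist Ω)))).mul hG.continuous
  have hB_zero : ∀ (n : ℕ) x, ((n : ℝ) * sdist Ω x ≤ 0 ∨ 1 ≤ (n : ℝ) * sdist Ω x) → B n x = 0 := by
    intro n x h
    simp only [B]
    rw [deriv_smoothTransition_eq_zero h, mul_zero, zero_mul]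
  have hkey : ∀ᶠ n : ℕ in Filter.atTop,
      ∫ x, φ n x * ∑ i, pd i (F i) x = -∫ x, B n x := by
    filter_upwards [eventually_one_lt_mul hδ] with n hn
    have hφ : ContDiff ℝ (⊤ : ℕ∞) (φ n) := contDiff_smoothTransition_sdist hδ hn hd
    have hi : ∀ i, Integrable (pd i fun x => φ n x * F i x) := fun i =>
      (continuous_pd i (hφ.mul (hF i))).integrable_of_hasCompactSupport
        (hasCompactSupport_pd i (hc i).mul_left)
    have h0 : ∫ x, ∑ i, pd i (fun x => φ n x * F i x) x = 0 := by
      rw [integral_finsetSum _ fun i _ => hi i]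
      exact Finset.sum_eq_zero fun i _ => integral_pd_eq_zero i (hφ.mul (hF i)) (hc i).mul_left
    have heq : ∀ x, ∑ i, pd i (fun x => φ n x * F i x) x = φ n x * ∑ i, pd i (F i) x + B n x := by
      intro x
      simp only [B, G, Finset.mul_sum, ← Finset.sum_add_distrib]
      refine Finset.sum_congr rfl fun i _ => ?_
      rw [pd_mul (hφ.differentiable_of_smooth x) ((hF i).differentiable_of_smooth x),
        pd_smoothTransition_sdist hδ hn hd hdN i x]
      ring
    simp only [heq] at h0
    rw [integral_add] at h0
    · linarith
    · exact ((hφ_cont n).mul hdiv_cont).integrable_of_hasCompactSupport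
        (HasCompactSupport.mul_left (HasCompactSupport.intro hK fun x hx =>
          Finset.sum_eq_zero fun i _ => by
            have : F i =ᶠ[nhds x] fun _ => 0 := by
              filter_upwards [hK.isClosed.isOpen_compl.mem_nhds hx] with y hy using hFK y hy i
            rw [pd_congr_of_eventuallyEq this]
            simp [pd]))
    · exact (hB_cont n).integrable_of_hasCompactSupport (hGc.mul_left)
  have hlim1 : Filter.Tendsto (fun n => ∫ x, φ n x * ∑ i, pd i (F i) x) Filter.atTop
      (nhds (∫ x, Ω.indicator (fun x => ∑ i, pd i (F i) x) x)) := by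
    refine tendsto_integral_of_dominated_convergence (fun x => |∑ i, pd i (F i) x|)
      (fun n => ((hφ_cont n).mul hdiv_cont).aestronglyMeasurable) hdiv_int.abs
      (fun n => Filter.Eventually.of_forall fun x => ?_)
      (Filter.Eventually.of_forall fun x => ?_)
    · rw [Real.norm_eq_abs, abs_mul, abs_of_nonneg (Real.smoothTransition.nonneg _)]
      exact mul_le_of_le_one_left (abs_nonneg _) (Real.smoothTransition.le_one _)
    · refine tendsto_const_nhds.congr' ?_
      by_cases hx : x ∈ Ω
      · filter_upwards [eventually_one_lt_mul (hΩ.sdist_pos_iff.2 hx)] with n hn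
        rw [Set.indicator_of_mem hx]
        simp only [φ]
        rw [Real.smoothTransition.one_of_one_le hn.le, one_mul]
      · refine Filter.Eventually.of_forall fun n => ?_
        rw [Set.indicator_of_notMem hx]
        simp only [φ]
        rw [Real.smoothTransition.zero_of_nonpos, zero_mul]
        exact mul_nonpos_of_nonneg_of_nonpos n.cast_nonneg
          (not_lt.1 fun h => hx (hΩ.sdist_pos_iff.1 h))
  have hlim2 : Filter.Tendsto (fun n => ∫ x, B n x) Filter.atTop (nhds (∫ _ : E3, (0 : ℝ))) := by
    refine tendsto_integral_of_dominated_convergence (K.indicator fun _ => M * L)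
      (fun n => (hB_cont n).aestronglyMeasurable)
      ((integrable_indicator_iff hK.measurableSet).2
        (integrableOn_const hK.measure_lt_top.ne))
      (fun n => Filter.Eventually.of_forall fun x => ?_)
      (Filter.Eventually.of_forall fun x => ?_)
    · by_cases hx : x ∈ K
      · rw [Set.indicator_of_mem hx]
        have hM0 : 0 ≤ M := (abs_nonneg _).trans (hM 0)
        by_cases h : (n : ℝ) * sdist Ω x ≤ 0 ∨ 1 ≤ (n : ℝ) * sdist Ω x
        · rw [hB_zero n x h, norm_zero]
          positivity
        · push Not at h
          have hd0 : 0 ≤ sdist Ω x := (pos_of_mul_pos_right h.1 n.cast_nonneg).le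
          rw [Real.norm_eq_abs, abs_mul, abs_mul, Nat.abs_cast]
          calc (n : ℝ) * |deriv Real.smoothTransition (n * sdist Ω x)| * |G x|
              ≤ n * M * (L * sdist Ω x) := by
                gcongr
                · exact hM _
                · exact hGd x hd0
            _ = M * L * (n * sdist Ω x) := by ring
            _ ≤ M * L * 1 := by
                gcongr
                exact h.2.le
            _ = M * L := mul_one _
      · rw [Set.indicator_of_notMem hx]
        simp [B, G, hFK x hx]
    · refine tendsto_const_nhds.congr' ?_
      rcases le_or_gt (sdist Ω x) 0 with h | h
      · exact Filter.Eventually.of_forall fun n =>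
          (hB_zero n x (Or.inl (mul_nonpos_of_nonneg_of_nonpos n.cast_nonneg h))).symm
      · filter_upwards [eventually_one_lt_mul h] with n hn
        exact (hB_zero n x (Or.inr hn.le)).symm
  have hlim := tendsto_nhds_unique (hlim1.congr' hkey) hlim2.neg
  rw [integral_indicator hΩ.isOpen.measurableSet] at hlim
  simpa using hlim

/-- The divergence theorem for integrable tangential fields with integrable divergence. -/
theorem ExteriorDomain.integral_div_eq_zero (hΩ : ExteriorDomain Ω)
    (hb : AnalyticBoundary Ω) {F : Fin 3 → E3 → ℝ} (hF : ∀ i, ContDiff ℝ (⊤ : ℕ∞) (F i))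
    (hint : ∀ i, IntegrableOn (F i) Ω) (hdiv : IntegrableOn (fun x => ∑ i, pd i (F i) x) Ω)
    (htan : ∀ x ∈ frontier Ω, ∑ i, F i x * pd i (sdist Ω) x = 0) :
    ∫ x in Ω, ∑ i, pd i (F i) x = 0 := by
  let χ : ContDiffBump (0 : E3) := ⟨1, 2, one_pos, one_lt_two⟩
  have hχ : ContDiff ℝ (⊤ : ℕ∞) (fun x => χ x) := χ.contDiff
  have hbound : ∀ i, ∃ C, ∀ x, |pd i (fun x => χ x) x| ≤ C := fun i =>
    (hasCompactSupport_pd i χ.hasCompactSupport).exists_bound_of_continuous (continuous_pd i hχ)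
  choose C hC using hbound
  let r : ℕ → ℝ := fun n => 1 / ((n : ℝ) + 1)
  have hr0 : ∀ n, 0 < r n := fun n => by positivity
  have hr1 : ∀ n, r n ≤ 1 := fun n => by
    simp only [r]
    rw [div_le_one (by positivity)]
    linarith [n.cast_nonneg (α := ℝ)]
  have hr : Filter.Tendsto r Filter.atTop (nhds 0) := tendsto_one_div_add_atTop_nhds_zero_nat
  let ψ : ℕ → E3 → ℝ := fun n x => χ (r n • x)
  have hψ : ∀ n, ContDiff ℝ (⊤ : ℕ∞) (ψ n) := fun n => hχ.comp (contDiff_const_smul (r n))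
  have hψc : ∀ n, HasCompactSupport (ψ n) := fun n => χ.hasCompactSupport.comp_smul (hr0 n).ne'
  have hψpd : ∀ n i x, pd i (ψ n) x = r n * pd i (fun x => χ x) (r n • x) := by
    intro n i x
    have h := (hχ.differentiable_of_smooth (r n • x)).hasFDerivAt.comp x
      ((hasFDerivAt_id x).const_smul (r n))
    have h' : fderiv ℝ (ψ n) x = _ := h.fderiv
    simp only [pd]
    rw [h']
    simp
  let T : ℕ → E3 → ℝ := fun n x => ∑ i, pd i (ψ n) x * F i x
  have hT_cont : ∀ n, Continuous (T n) := fun n =>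
    continuous_finsetSum _ fun i _ => (continuous_pd i (hψ n)).mul (hF i).continuous
  have hdiv_cont : Continuous fun x => ∑ i, pd i (F i) x :=
    continuous_finsetSum _ fun i _ => continuous_pd i (hF i)
  have hbd : ∀ n x, ‖ψ n x * ∑ i, pd i (F i) x‖ ≤ |∑ i, pd i (F i) x| := by
    intro n x
    rw [Real.norm_eq_abs, abs_mul, abs_of_nonneg χ.nonneg]
    exact mul_le_of_le_one_left (abs_nonneg _) χ.le_one
  have hTbd : ∀ n x, ‖T n x‖ ≤ ∑ i, C i * |F i x| := by
    intro n x
    refine (norm_sum_le _ _).trans (Finset.sum_le_sum fun i _ => ?_)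
    rw [hψpd, Real.norm_eq_abs, abs_mul, abs_mul, abs_of_pos (hr0 n)]
    gcongr
    exact (mul_le_of_le_one_left (abs_nonneg _) (hr1 n)).trans (hC i _)
  have hTint : IntegrableOn (fun x => ∑ i, C i * |F i x|) Ω :=
    integrable_finsetSum _ fun i _ => (hint i).abs.const_mul (C i)
  have hkey : ∀ n, ∫ x in Ω, ψ n x * ∑ i, pd i (F i) x = -∫ x in Ω, T n x := by
    intro n
    have h0 := hΩ.integral_div_eq_zero_of_hasCompactSupport hb
      (F := fun i x => ψ n x * F i x) (fun i => (hψ n).mul (hF i))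
      (fun i => (hψc n).mul_right) (fun x hx => by
        simp only [mul_assoc]
        rw [← Finset.mul_sum, htan x hx, mul_zero])
    have heq : ∀ x, ∑ i, pd i (fun x => ψ n x * F i x) x = ψ n x * ∑ i, pd i (F i) x + T n x := by
      intro x
      simp only [T, Finset.mul_sum, ← Finset.sum_add_distrib]
      refine Finset.sum_congr rfl fun i _ => ?_
      rw [pd_mul ((hψ n).differentiable_of_smooth x) ((hF i).differentiable_of_smooth x)]
      ring
    simp only [heq] at h0
    rw [integral_add] at h0
    · linarith
    · exact hdiv.abs.mono' ((hψ n).continuous.mul hdiv_cont).aestronglyMeasurable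
        (Filter.Eventually.of_forall (hbd n))
    · exact hTint.mono' (hT_cont n).aestronglyMeasurable (Filter.Eventually.of_forall (hTbd n))
  have hlim1 : Filter.Tendsto (fun n => ∫ x in Ω, ψ n x * ∑ i, pd i (F i) x) Filter.atTop
      (nhds (∫ x in Ω, ∑ i, pd i (F i) x)) := by
    refine tendsto_integral_of_dominated_convergence (fun x => |∑ i, pd i (F i) x|)
      (fun n => ((hψ n).continuous.mul hdiv_cont).aestronglyMeasurable) hdiv.abs
      (fun n => Filter.Eventually.of_forall (hbd n))
      (Filter.Eventually.of_forall fun x => ?_)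
    have h1 : Filter.Tendsto (fun n => ψ n x) Filter.atTop (nhds (χ ((0 : ℝ) • x))) :=
      (hχ.continuous.tendsto _).comp (hr.smul_const x)
    rw [zero_smul, χ.one_of_mem_closedBall (by simp [χ])] at h1
    simpa using h1.mul_const (∑ i, pd i (F i) x)
  have hlim2 : Filter.Tendsto (fun n => ∫ x in Ω, T n x) Filter.atTop
      (nhds (∫ _ in Ω, (0 : ℝ))) := by
    refine tendsto_integral_of_dominated_convergence (fun x => ∑ i, C i * |F i x|)
      (fun n => (hT_cont n).aestronglyMeasurable) hTint
      (fun n => Filter.Eventually.of_forall (hTbd n))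
      (Filter.Eventually.of_forall fun x => ?_)
    have : ∀ i ∈ Finset.univ, Filter.Tendsto (fun n => pd i (ψ n) x * F i x) Filter.atTop
        (nhds 0) := by
      intro i _
      have h1 : Filter.Tendsto (fun n => pd i (ψ n) x) Filter.atTop
          (nhds (0 * pd i (fun x => χ x) ((0 : ℝ) • x))) := by
        simp only [hψpd]
        exact hr.mul (((continuous_pd i hχ).tendsto _).comp (hr.smul_const x))
      simpa using h1.mul_const (F i x)
    simpa using tendsto_finsetSum _ this
  have hlim := tendsto_nhds_unique (hlim1.congr hkey) hlim2.neg
  simpa using hlim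

end DivergenceTheorem

section DivCurl

variable {Ω : Set E3}

/-- The pointwise squared norm of the Jacobian matrix. -/
def gradSq (v : E3 → Fin 3 → ℝ) (x : E3) : ℝ :=
  ∑ m, ∑ j, pd j (fun y => v y m) x ^ 2

/-- The pointwise squared norm of a vector field. -/
def normSq (v : E3 → Fin 3 → ℝ) (x : E3) : ℝ :=
  ∑ m, v x m ^ 2

theorem gradSq_nonneg (v : E3 → Fin 3 → ℝ) (x : E3) : 0 ≤ gradSq v x :=
  Finset.sum_nonneg fun _ _ => Finset.sum_nonneg fun _ _ => sq_nonneg _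

theorem normSq_nonneg (v : E3 → Fin 3 → ℝ) (x : E3) : 0 ≤ normSq v x :=
  Finset.sum_nonneg fun _ _ => sq_nonneg _

theorem sq_pd_le_gradSq (v : E3 → Fin 3 → ℝ) (m j : Fin 3) (x : E3) :
    pd j (fun y => v y m) x ^ 2 ≤ gradSq v x :=
  (Finset.single_le_sum (f := fun j => pd j (fun y => v y m) x ^ 2)
    (fun _ _ => sq_nonneg _) (Finset.mem_univ j)).trans
  (Finset.single_le_sum (f := fun m => ∑ j, pd j (fun y => v y m) x ^ 2)
    (fun _ _ => Finset.sum_nonneg fun _ _ => sq_nonneg _) (Finset.mem_univ m))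

theorem sq_le_normSq (v : E3 → Fin 3 → ℝ) (m : Fin 3) (x : E3) : v x m ^ 2 ≤ normSq v x :=
  Finset.single_le_sum (f := fun m => v x m ^ 2) (fun _ _ => sq_nonneg _) (Finset.mem_univ m)

theorem sum_sq_curl3_le (v : E3 → Fin 3 → ℝ) (x : E3) :
    ∑ m, curl3 v x m ^ 2 ≤ 2 * gradSq v x := by
  have h : ∀ a b : ℝ, (a - b) ^ 2 ≤ 2 * a ^ 2 + 2 * b ^ 2 := fun a b => by
    nlinarith [sq_nonneg (a + b)]
  simp only [curl3, gradSq, Fin.sum_univ_three, Matrix.cons_val]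
  have h1 := h (pd 1 (fun y => v y 2) x) (pd 2 (fun y => v y 1) x)
  have h2 := h (pd 2 (fun y => v y 0) x) (pd 0 (fun y => v y 2) x)
  have h3 := h (pd 0 (fun y => v y 1) x) (pd 1 (fun y => v y 0) x)
  have h4 := sq_nonneg (pd 0 (fun y => v y 0) x)
  have h5 := sq_nonneg (pd 1 (fun y => v y 1) x)
  have h6 := sq_nonneg (pd 2 (fun y => v y 2) x)
  linarith

theorem sq_div3_le (v : E3 → Fin 3 → ℝ) (x : E3) : div3 v x ^ 2 ≤ 3 * gradSq v x := by
  have h : div3 v x ^ 2 ≤ 3 * ∑ m, pd m (fun y => v y m) x ^ 2 := by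
    simpa [div3] using sq_sum_le_card_mul_sum_sq (s := Finset.univ)
      (f := fun m => pd m (fun y => v y m) x)
  refine h.trans (mul_le_mul_of_nonneg_left (Finset.sum_le_sum fun m _ => ?_) (by norm_num))
  exact Finset.single_le_sum (f := fun j => pd j (fun y => v y m) x ^ 2)
    (fun _ _ => sq_nonneg _) (Finset.mem_univ m)

/-- `div ((v·∇)v - (div v) v) = |∇v|² - |curl v|² - (div v)²`. -/
theorem div_convection_sub (v : E3 → Fin 3 → ℝ)
    (hv : ∀ m, ContDiff ℝ (⊤ : ℕ∞) (fun x => v x m)) (x : E3) :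
    ∑ k, pd k (fun x => ∑ j, (v x j * pd j (fun y => v y k) x -
      v x k * pd j (fun y => v y j) x)) x =
      gradSq v x - ∑ m, curl3 v x m ^ 2 - div3 v x ^ 2 := by
  have hd : ∀ m, DifferentiableAt ℝ (fun y => v y m) x := fun m => (hv m).differentiable_of_smooth x
  have hdd : ∀ j m, DifferentiableAt ℝ (pd j fun y => v y m) x := fun j m =>
    (contDiff_pd j (hv m)).differentiable_of_smooth x
  have hexp : ∀ k, pd k (fun x => ∑ j, (v x j * pd j (fun y => v y k) x -
      v x k * pd j (fun y => v y j) x)) x =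
      ∑ j, ((pd k (fun y => v y j) x * pd j (fun y => v y k) x +
        v x j * pd k (pd j fun y => v y k) x) -
        (pd k (fun y => v y k) x * pd j (fun y => v y j) x +
        v x k * pd k (pd j fun y => v y j) x)) := by
    intro k
    rw [pd_sum _ fun j _ => ((hd j).fun_mul (hdd j k)).fun_sub ((hd k).fun_mul (hdd j j))]
    refine Finset.sum_congr rfl fun j _ => ?_
    rw [pd_sub ((hd j).fun_mul (hdd j k)) ((hd k).fun_mul (hdd j j)), pd_mul (hd j) (hdd j k),
      pd_mul (hd k) (hdd j j)]
  simp only [hexp]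
  simp only [gradSq, curl3, div3, Fin.sum_univ_three, Matrix.cons_val]
  rw [pd_comm 1 0 (hv 0) x, pd_comm 2 0 (hv 0) x, pd_comm 1 0 (hv 1) x, pd_comm 2 1 (hv 1) x,
    pd_comm 2 0 (hv 2) x, pd_comm 2 1 (hv 2) x]
  ring

theorem exists_uniform_bound {ι : Type*} [Fintype ι] {c : ι → E3 → ℝ}
    (hc : ∀ p, Continuous (c p)) (hs : ∀ p, HasCompactSupport (c p)) :
    ∃ B : ℝ, 0 ≤ B ∧ ∀ p x, |c p x| ≤ B := by
  choose b hb using fun p => (hs p).exists_bound_of_continuous (hc p)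
  refine ⟨∑ p, |b p|, Finset.sum_nonneg fun _ _ => abs_nonneg _, fun p x => ?_⟩
  exact ((hb p x).trans (le_abs_self _)).trans
    (Finset.single_le_sum (f := fun p => |b p|) (fun _ _ => abs_nonneg _) (Finset.mem_univ p))

/-- The divergence of a field that is quadratic in `v` with smooth compactly supported coefficients
is controlled by `|v|²` and a small multiple of `|∇v|²`. -/
theorem exists_bound_div_quadratic (c : Fin 3 → Fin 3 → Fin 3 → E3 → ℝ)
    (hc : ∀ i j k, ContDiff ℝ (⊤ : ℕ∞) (c i j k)) (hs : ∀ i j k, HasCompactSupport (c i j k)) :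
    ∃ C : ℝ, 0 ≤ C ∧ ∀ v : E3 → Fin 3 → ℝ, (∀ m, ContDiff ℝ (⊤ : ℕ∞) (fun x => v x m)) →
      ∀ x, |∑ k, pd k (fun x => ∑ i, ∑ j, v x i * v x j * c i j k x) x| ≤
        gradSq v x / 2 + C * normSq v x := by
  obtain ⟨B₀, hB₀, hb₀⟩ := exists_uniform_bound (ι := Fin 3 × Fin 3 × Fin 3)
    (c := fun p => c p.1 p.2.1 p.2.2) (fun p => (hc _ _ _).continuous) (fun p => hs _ _ _)
  obtain ⟨B₁, hB₁, hb₁⟩ := exists_uniform_bound (ι := Fin 3 × Fin 3 × Fin 3)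
    (c := fun p => pd p.2.2 (c p.1 p.2.1 p.2.2)) (fun p => continuous_pd _ (hc _ _ _))
    (fun p => hasCompactSupport_pd _ (hs _ _ _))
  refine ⟨(54 * B₀) ^ 2 / 2 + 27 * B₁, by positivity, fun v hv x => ?_⟩
  have hd : ∀ m, DifferentiableAt ℝ (fun y => v y m) x := fun m => (hv m).differentiable_of_smooth x
  have hdc : ∀ i j k, DifferentiableAt ℝ (c i j k) x := fun i j k =>
    (hc i j k).differentiable_of_smooth x
  set g := Real.sqrt (gradSq v x) with hg
  set s := Real.sqrt (normSq v x) with hs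
  have hg0 : 0 ≤ g := Real.sqrt_nonneg _
  have hs0 : 0 ≤ s := Real.sqrt_nonneg _
  have hg2 : g ^ 2 = gradSq v x := Real.sq_sqrt (gradSq_nonneg v x)
  have hs2 : s ^ 2 = normSq v x := Real.sq_sqrt (normSq_nonneg v x)
  have hpg : ∀ k m, |pd k (fun y => v y m) x| ≤ g := fun k m =>
    Real.abs_le_sqrt (sq_pd_le_gradSq v m k x)
  have hvs : ∀ m, |v x m| ≤ s := fun m => Real.abs_le_sqrt (sq_le_normSq v m x)
  have hterm : ∀ i j k, |pd k (fun x => v x i * v x j * c i j k x) x| ≤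
      2 * B₀ * g * s + B₁ * s ^ 2 := by
    intro i j k
    rw [pd_mul ((hd i).fun_mul (hd j)) (hdc i j k), pd_mul (hd i) (hd j)]
    calc |(pd k (fun y => v y i) x * v x j + v x i * pd k (fun y => v y j) x) * c i j k x +
          v x i * v x j * pd k (c i j k) x|
        ≤ (|pd k (fun y => v y i) x| * |v x j| + |v x i| * |pd k (fun y => v y j) x|) *
            |c i j k x| + |v x i| * |v x j| * |pd k (c i j k) x| := by
          refine (abs_add_le _ _).trans (add_le_add ?_ (by rw [abs_mul, abs_mul]))
          rw [abs_mul]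
          refine mul_le_mul_of_nonneg_right ((abs_add_le _ _).trans ?_) (abs_nonneg _)
          rw [abs_mul, abs_mul]
      _ ≤ (g * s + s * g) * B₀ + s * s * B₁ := by
          gcongr
          · exact hpg k i
          · exact hvs j
          · exact hvs i
          · exact hpg k j
          · exact hb₀ (i, j, k) x
          · exact hvs i
          · exact hvs j
          · exact hb₁ (i, j, k) x
      _ = 2 * B₀ * g * s + B₁ * s ^ 2 := by ring
  have hsum : |∑ k, pd k (fun x => ∑ i, ∑ j, v x i * v x j * c i j k x) x| ≤
      ∑ _k : Fin 3, ∑ _i : Fin 3, ∑ _j : Fin 3, (2 * B₀ * g * s + B₁ * s ^ 2) := by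
    refine (Finset.abs_sum_le_sum_abs _ _).trans (Finset.sum_le_sum fun k _ => ?_)
    rw [pd_sum _ fun i _ => DifferentiableAt.fun_sum fun j _ =>
      ((hd i).fun_mul (hd j)).fun_mul (hdc i j k)]
    refine (Finset.abs_sum_le_sum_abs _ _).trans (Finset.sum_le_sum fun i _ => ?_)
    rw [pd_sum _ fun j _ => ((hd i).fun_mul (hd j)).fun_mul (hdc i j k)]
    exact (Finset.abs_sum_le_sum_abs _ _).trans (Finset.sum_le_sum fun j _ => hterm i j k)
  refine hsum.trans ?_
  simp only [Finset.sum_const, Finset.card_univ, Fintype.card_fin, nsmul_eq_mul]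
  rw [← hg2, ← hs2]
  push_cast
  nlinarith [sq_nonneg (g - 54 * B₀ * s)]

/-- A function vanishing on the boundary has zero tangential derivatives there. -/
theorem ExteriorDomain.tangential_deriv_eq_zero (hΩ : ExteriorDomain Ω) {g : E3 → ℝ}
    (hg : ContDiff ℝ (⊤ : ℕ∞) g) (hg0 : ∀ x ∈ frontier Ω, g x = 0) {p : E3} (hp : p ∈ frontier Ω)
    (hd : ContDiffAt ℝ (⊤ : ℕ∞) (sdist Ω) p) (hne : ∃ i, pd i (sdist Ω) p ≠ 0) {w : Fin 3 → ℝ}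
    (hw : ∑ i, w i * pd i (sdist Ω) p = 0) : ∑ i, w i * pd i g p = 0 := by
  have hext : IsLocalExtrOn g {x | sdist Ω x = sdist Ω p} p := by
    refine Or.inl (Filter.eventually_of_mem self_mem_nhdsWithin fun x hx => ?_)
    have hx : sdist Ω x = sdist Ω p := hx
    rw [hΩ.sdist_eq_zero_iff.2 hp, hΩ.sdist_eq_zero_iff] at hx
    rw [hg0 x hx, hg0 p hp]
  obtain ⟨a, b, hab, h⟩ := hext.exists_multipliers_of_hasStrictFDerivAt_1d
    (hd.hasStrictFDerivAt (by simp)) (hg.contDiffAt.hasStrictFDerivAt (by simp))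
  have hi : ∀ i, a * pd i (sdist Ω) p + b * pd i g p = 0 := fun i => by
    simpa [pd] using congrArg (fun L => L (EuclideanSpace.single i 1)) h
  have hb : b ≠ 0 := by
    rintro rfl
    obtain ⟨i, hi'⟩ := hne
    have : a = 0 := by simpa [hi'] using hi i
    exact hab (by simp [this])
  have : b * ∑ i, w i * pd i g p = 0 := by
    calc b * ∑ i, w i * pd i g p
        = ∑ i, (w i * (a * pd i (sdist Ω) p + b * pd i g p) - a * (w i * pd i (sdist Ω) p)) := by
          rw [Finset.mul_sum]
          exact Finset.sum_congr rfl fun i _ => by ring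
      _ = 0 := by
          rw [Finset.sum_sub_distrib, ← Finset.mul_sum, hw]
          simp [hi]
  exact (mul_eq_zero.1 this).resolve_left hb

theorem integrableOn_mul_of_sq {f g : E3 → ℝ} (hf : Continuous f) (hg : Continuous g)
    (hf2 : IntegrableOn (fun x => f x ^ 2) Ω) (hg2 : IntegrableOn (fun x => g x ^ 2) Ω) :
    IntegrableOn (fun x => f x * g x) Ω := by
  refine (hf2.add hg2).mono' (hf.mul hg).aestronglyMeasurable
    (Filter.Eventually.of_forall fun x => ?_)
  simp only [Pi.add_apply]
  rw [Real.norm_eq_abs, abs_le]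
  constructor <;> nlinarith [sq_nonneg (f x + g x), sq_nonneg (f x - g x)]

theorem continuous_div3 {v : E3 → Fin 3 → ℝ}
    (hv : ∀ m, ContDiff ℝ (⊤ : ℕ∞) (fun x => v x m)) : Continuous (div3 v) :=
  continuous_finsetSum _ fun m _ => continuous_pd m (hv m)

theorem continuous_curl3 {v : E3 → Fin 3 → ℝ}
    (hv : ∀ m, ContDiff ℝ (⊤ : ℕ∞) (fun x => v x m)) (m : Fin 3) :
    Continuous fun x => curl3 v x m := by
  have h : ∀ i j k l, Continuous fun x => pd i (fun y => v y j) x - pd k (fun y => v y l) x :=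
    fun i j k l => (continuous_pd i (hv j)).sub (continuous_pd k (hv l))
  fin_cases m
  exacts [h 1 2 2 1, h 2 0 0 2, h 0 1 1 0]

/-- The div–curl energy estimate for smooth tangential fields. -/
theorem ExteriorDomain.exists_integral_gradSq_le (hΩ : ExteriorDomain Ω)
    (hb : AnalyticBoundary Ω) :
    ∃ C : ℝ, 0 ≤ C ∧ ∀ v : E3 → Fin 3 → ℝ,
      (∀ m, ContDiff ℝ (⊤ : ℕ∞) (fun x => v x m)) →
      (∀ m, InH Ω 1 (fun x => v x m)) →
      (∀ x ∈ frontier Ω, ∑ i, v x i * nuv Ω x i = 0) →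
      IntegrableOn (gradSq v) Ω ∧ ∫ x in Ω, gradSq v x ≤
        2 * (∫ x in Ω, div3 v x ^ 2) + 2 * (∫ x in Ω, ∑ m, curl3 v x m ^ 2) +
          2 * C * ∫ x in Ω, ∑ m, v x m ^ 2 := by
  obtain ⟨N, Z, δ, hδ, hN, hZ, hZc, hnear⟩ := hΩ.exists_normal_fields hb
  have hbd : ∀ x ∈ frontier Ω, ContDiffAt ℝ (⊤ : ℕ∞) (sdist Ω) x ∧
      (∀ j, pd j (sdist Ω) x = N j x) ∧ ∑ j, N j x * Z j x = 1 := fun x hx => by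
    have h0 := hΩ.sdist_eq_zero_iff.2 hx
    exact hnear x h0.ge (h0 ▸ hδ)
  let c : Fin 3 → Fin 3 → Fin 3 → E3 → ℝ := fun i j k x => pd i (N j) x * Z k x
  have hc : ∀ i j k, ContDiff ℝ (⊤ : ℕ∞) (c i j k) := fun i j k =>
    (contDiff_pd i (hN j)).mul (hZ k)
  have hcs : ∀ i j k, HasCompactSupport (c i j k) := fun i j k => (hZc k).mul_left
  obtain ⟨B, -, hB⟩ := exists_uniform_bound (ι := Fin 3 × Fin 3 × Fin 3)
    (c := fun p => c p.1 p.2.1 p.2.2) (fun p => (hc _ _ _).continuous) (fun p => hcs _ _ _)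
  obtain ⟨C, hC, hCR⟩ := exists_bound_div_quadratic c hc hcs
  refine ⟨C, hC, fun v hv hH htan => ?_⟩
  have hvc : ∀ m, Continuous fun x => v x m := fun m => (hv m).continuous
  have hpc : ∀ j m, Continuous (pd j fun x => v x m) := fun j m => continuous_pd j (hv m)
  have hv2 : ∀ m, IntegrableOn (fun x => v x m ^ 2) Ω := fun m => hH m [] (by simp)
  have hp2 : ∀ j m, IntegrableOn (fun x => pd j (fun y => v y m) x ^ 2) Ω :=
    fun j m => hH m [j] (by simp)
  have hG : IntegrableOn (gradSq v) Ω :=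
    integrable_finsetSum _ fun m _ => integrable_finsetSum _ fun j _ => hp2 j m
  have hS : IntegrableOn (normSq v) Ω := integrable_finsetSum _ fun m _ => hv2 m
  have hcurl : IntegrableOn (fun x => ∑ m, curl3 v x m ^ 2) Ω :=
    (hG.const_mul 2).mono' (continuous_finsetSum _ fun m _ =>
      (continuous_curl3 hv m).pow 2).aestronglyMeasurable (Filter.Eventually.of_forall fun x => by
        rw [Real.norm_eq_abs, abs_of_nonneg (Finset.sum_nonneg fun _ _ => sq_nonneg _)]
        exact sum_sq_curl3_le v x)
  have hdiv : IntegrableOn (fun x => div3 v x ^ 2) Ω :=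
    (hG.const_mul 3).mono' ((continuous_div3 hv).pow 2).aestronglyMeasurable
      (Filter.Eventually.of_forall fun x => by
        rw [Real.norm_eq_abs, abs_of_nonneg (sq_nonneg _)]
        exact sq_div3_le v x)
  let W : Fin 3 → E3 → ℝ := fun k x =>
    ∑ j, (v x j * pd j (fun y => v y k) x - v x k * pd j (fun y => v y j) x)
  let Y : Fin 3 → E3 → ℝ := fun k x => ∑ i, ∑ j, v x i * v x j * c i j k x
  have hW : ∀ k, ContDiff ℝ (⊤ : ℕ∞) (W k) := fun k => ContDiff.sum fun j _ =>
    ((hv j).mul (contDiff_pd j (hv k))).sub ((hv k).mul (contDiff_pd j (hv j)))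
  have hY : ∀ k, ContDiff ℝ (⊤ : ℕ∞) (Y k) := fun k => ContDiff.sum fun i _ =>
    ContDiff.sum fun j _ => ((hv i).mul (hv j)).mul (hc i j k)
  let R : E3 → ℝ := fun x => ∑ k, pd k (Y k) x
  have hRc : Continuous R := continuous_finsetSum _ fun k _ => continuous_pd k (hY k)
  have hRb : ∀ x, |R x| ≤ gradSq v x / 2 + C * normSq v x := hCR v hv
  have hRbi : IntegrableOn (fun x => gradSq v x / 2 + C * normSq v x) Ω :=
    (hG.div_const 2).add (hS.const_mul C)
  have hR : IntegrableOn R Ω :=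
    hRbi.mono' hRc.aestronglyMeasurable (Filter.Eventually.of_forall hRb)
  have hdivF : ∀ x, ∑ k, pd k (fun x => W k x + Y k x) x =
      gradSq v x - ∑ m, curl3 v x m ^ 2 - div3 v x ^ 2 + R x := by
    intro x
    rw [← div_convection_sub v hv x, ← Finset.sum_add_distrib]
    exact Finset.sum_congr rfl fun k _ => pd_add ((hW k).differentiable_of_smooth x)
      ((hY k).differentiable_of_smooth x)
  have hFi : ∀ k, IntegrableOn (fun x => W k x + Y k x) Ω := by
    intro k
    refine Integrable.add (integrable_finsetSum _ fun j _ => ?_)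
      (integrable_finsetSum _ fun i _ => integrable_finsetSum _ fun j _ => ?_)
    · exact (integrableOn_mul_of_sq (hvc j) (hpc j k) (hv2 j) (hp2 j k)).sub
        (integrableOn_mul_of_sq (hvc k) (hpc j j) (hv2 k) (hp2 j j))
    · refine ((integrableOn_mul_of_sq (hvc i) (hvc j) (hv2 i) (hv2 j)).abs.mul_const B).mono'
        (((hvc i).mul (hvc j)).mul (hc i j k).continuous).aestronglyMeasurable
        (Filter.Eventually.of_forall fun x => ?_)
      rw [Real.norm_eq_abs, abs_mul]
      exact mul_le_mul_of_nonneg_left (hB (i, j, k) x) (abs_nonneg _)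
  let g : E3 → ℝ := fun x => ∑ m, v x m * N m x
  have hg : ContDiff ℝ (⊤ : ℕ∞) g := ContDiff.sum fun m _ => (hv m).mul (hN m)
  have hvd : ∀ x ∈ frontier Ω, ∑ i, v x i * pd i (sdist Ω) x = 0 := fun x hx => by
    simpa [nuv] using htan x hx
  have hg0 : ∀ x ∈ frontier Ω, g x = 0 := fun x hx => by
    rw [← hvd x hx]
    exact Finset.sum_congr rfl fun i _ => by rw [(hbd x hx).2.1 i]
  have hFtan : ∀ x ∈ frontier Ω, ∑ k, (W k x + Y k x) * pd k (sdist Ω) x = 0 := by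
    intro x hx
    obtain ⟨hd, hdN, hNZ⟩ := hbd x hx
    have hne : ∃ i, pd i (sdist Ω) x ≠ 0 := by
      by_contra! h
      simp [← hdN, h] at hNZ
    have hvg := hΩ.tangential_deriv_eq_zero hg hg0 hx hd hne (hvd x hx)
    have hpg : ∀ j, pd j g x = ∑ m, (pd j (fun y => v y m) x * N m x + v x m * pd j (N m) x) := by
      intro j
      have hdv : ∀ m, DifferentiableAt ℝ (fun y => v y m) x := fun m =>
        (hv m).differentiable_of_smooth x
      have hdn : ∀ m, DifferentiableAt ℝ (N m) x := fun m => (hN m).differentiable_of_smooth x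
      refine (pd_sum _ fun m _ => (hdv m).fun_mul (hdn m)).trans ?_
      exact Finset.sum_congr rfl fun m _ => pd_mul (hdv m) (hdn m)
    have hgx : g x = 0 := hg0 x hx
    simp only [hpg, Fin.sum_univ_three] at hvg
    simp only [g, Fin.sum_univ_three] at hgx
    simp only [Fin.sum_univ_three] at hNZ
    simp only [hdN, W, Y, c, Fin.sum_univ_three]
    set a : ℝ := ∑ i, ∑ j, v x i * v x j * pd i (N j) x with ha
    simp only [Fin.sum_univ_three] at ha
    linear_combination hvg - (pd 0 (fun y => v y 0) x + pd 1 (fun y => v y 1) x +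
      pd 2 (fun y => v y 2) x) * hgx + a * hNZ +
      (1 - (N 0 x * Z 0 x + N 1 x * Z 1 x + N 2 x * Z 2 x)) * ha
  have hGc : IntegrableOn (fun x => gradSq v x - ∑ m, curl3 v x m ^ 2) Ω := hG.sub hcurl
  have hGcd : IntegrableOn (fun x => gradSq v x - ∑ m, curl3 v x m ^ 2 - div3 v x ^ 2) Ω :=
    hGc.sub hdiv
  have hdivFi : IntegrableOn (fun x => ∑ k, pd k (fun x => W k x + Y k x) x) Ω := by
    simp only [hdivF]
    exact hGcd.add hR
  have hzero := hΩ.integral_div_eq_zero hb (fun k => (hW k).add (hY k)) hFi hdivFi hFtan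
  simp only [hdivF] at hzero
  rw [integral_add hGcd hR, integral_sub hGc hdiv, integral_sub hG hcurl] at hzero
  have hRle : -∫ x in Ω, R x ≤ ∫ x in Ω, (gradSq v x / 2 + C * normSq v x) := by
    rw [← integral_neg]
    exact integral_mono hR.neg hRbi fun x => (neg_le_abs _).trans (hRb x)
  rw [integral_add (hG.div_const 2) (hS.const_mul C), integral_div, integral_const_mul] at hRle
  refine ⟨hG, ?_⟩
  have hSeq : ∫ x in Ω, normSq v x = ∫ x in Ω, ∑ m, v x m ^ 2 := rfl
  rw [hSeq] at hRle
  linarith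

theorem DnormL2v_one_le {v : E3 → Fin 3 → ℝ} (hG : IntegrableOn (gradSq v) Ω) :
    DnormL2v Ω 1 v ≤ 9 * Real.sqrt (∫ x in Ω, gradSq v x) := by
  have h : ∀ (m : Fin 3) (ι : Fin 1 → Fin 3),
      L2 Ω (pdList (List.ofFn ι) fun x => v x m) ≤ Real.sqrt (∫ x in Ω, gradSq v x) := by
    intro m ι
    refine Real.sqrt_le_sqrt (integral_mono_of_nonneg
      (Filter.Eventually.of_forall fun x => sq_nonneg _) hG
      (Filter.Eventually.of_forall fun x => ?_))
    simpa [pdList] using sq_pd_le_gradSq v m (ι 0) x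
  calc DnormL2v Ω 1 v
      ≤ ∑ _m : Fin 3, ∑ _ι : Fin 1 → Fin 3, Real.sqrt (∫ x in Ω, gradSq v x) :=
        Finset.sum_le_sum fun m _ => Finset.sum_le_sum fun ι _ => h m ι
    _ = 9 * Real.sqrt (∫ x in Ω, gradSq v x) := by
        simp
        ring

end DivCurl

/-- div–curl estimate of Bourguignon–Brezis, Lemma 4.3.
Let `Ω` be an exterior domain in `ℝ³` with real-analytic boundary and
outward unit normal `ν`. Then there is `C > 0` such that every
`v ∈ H¹(Ω;ℝ³)` with `v·ν = 0` on `∂Ω` satisfies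
`‖∇v‖_{L²(Ω)} ≤ C (‖div v‖_{L²(Ω)} + ‖curl v‖_{L²(Ω)} + ‖v‖_{L²(Ω)})`. -/
theorem stmt5 (Ω : Set E3) (hΩ : ExteriorDomain Ω) (hb : AnalyticBoundary Ω) :
    ∃ C : ℝ, 0 < C ∧
      ∀ v : E3 → Fin 3 → ℝ,
        (∀ m : Fin 3, ContDiff ℝ (⊤ : ℕ∞) (fun x => v x m)) →
        (∀ m : Fin 3, InH Ω 1 (fun x => v x m)) →
        (∀ x ∈ frontier Ω, ∑ i, v x i * nuv Ω x i = 0) →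
        DnormL2v Ω 1 v ≤ C * (L2 Ω (div3 v) + L2v Ω (curl3 v) + L2v Ω v) := by
  obtain ⟨C, hC, hest⟩ := hΩ.exists_integral_gradSq_le hb
  refine ⟨9 * (2 + 2 * C), by positivity, fun v hv hH htan => ?_⟩
  obtain ⟨hG, hle⟩ := hest v hv hH htan
  refine (DnormL2v_one_le hG).trans ?_
  have hnn : 0 ≤ L2 Ω (div3 v) ∧ 0 ≤ L2v Ω (curl3 v) ∧ 0 ≤ L2v Ω v :=
    ⟨Real.sqrt_nonneg _, Real.sqrt_nonneg _, Real.sqrt_nonneg _⟩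
  have hd : L2 Ω (div3 v) ^ 2 = ∫ x in Ω, div3 v x ^ 2 :=
    Real.sq_sqrt (integral_nonneg fun x => sq_nonneg _)
  have hc : L2v Ω (curl3 v) ^ 2 = ∫ x in Ω, ∑ m, curl3 v x m ^ 2 :=
    Real.sq_sqrt (integral_nonneg fun x => Finset.sum_nonneg fun _ _ => sq_nonneg _)
  have hs : L2v Ω v ^ 2 = ∫ x in Ω, ∑ m, v x m ^ 2 :=
    Real.sq_sqrt (integral_nonneg fun x => Finset.sum_nonneg fun _ _ => sq_nonneg _)
  rw [← hd, ← hc, ← hs] at hle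
  obtain ⟨hp, hq, hr⟩ := hnn
  generalize L2 Ω (div3 v) = p at *
  generalize L2v Ω (curl3 v) = q at *
  generalize L2v Ω v = r at *
  rw [mul_assoc]
  refine mul_le_mul_of_nonneg_left (Real.sqrt_le_iff.2 ⟨by positivity, ?_⟩) (by norm_num)
  have h1 : p ^ 2 + q ^ 2 + r ^ 2 ≤ (p + q + r) ^ 2 := by
    nlinarith [mul_nonneg hp hq, mul_nonneg hp hr, mul_nonneg hq hr]
  calc ∫ x in Ω, gradSq v x ≤ 2 * p ^ 2 + 2 * q ^ 2 + 2 * C * r ^ 2 := hle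
    _ ≤ (2 + 2 * C) * (p ^ 2 + q ^ 2 + r ^ 2) := by
      nlinarith [mul_nonneg hC (sq_nonneg p), mul_nonneg hC (sq_nonneg q), sq_nonneg r]
    _ ≤ (2 + 2 * C) ^ 2 * (p + q + r) ^ 2 := by
      gcongr
      nlinarith
    _ = ((2 + 2 * C) * (p + q + r)) ^ 2 := by ring

end
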